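/- arXiv:math/0106245 — 9 statements merged into one kernel-verified Lean document; each statement's English description precedes it below -/
import Mathlib

section
/- Let k be a field with 2 ≠ 0 in k, n a natural number, a : Fin n → kˣ, and A = diagonal(a) the diagonal n×n matrix with entries a_i. Let X be an n×n matrix over k satisfying X·A + A·Xᵀ = 0. Then: (i) X i i = 0 for every i; (ii) X j i = -(a j / a i)·(X i j) for all i, j; and (iii) trace(X·X) = -2·∑_{i<j} (a j / a i)·(X i j)², where the sum is over pairs of indices i < j. -/
open Matrix

/-- The sum of a symmetric function vanishing on the diagonal is twice its sum over the pairs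
`i < j`. -/
lemma sum_prod_eq_two_mul_sum_lt {ι R : Type*} [Fintype ι] [LinearOrder ι] [Semiring R]
    (f : ι × ι → R) (hdiag : ∀ i, f (i, i) = 0) (hswap : ∀ p, f p.swap = f p) :
    ∑ p, f p = 2 * ∑ p ∈ Finset.univ.filter (fun p : ι × ι => p.1 < p.2), f p := by
  have hsplit : ∀ p : ι × ι,
      f p = (if p.1 < p.2 then f p else 0) + (if p.2 < p.1 then f p else 0) := by
    rintro ⟨i, j⟩
    rcases lt_trichotomy i j with h | rfl | h
    · simp [h, h.not_gt]
    · simp [hdiag]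
    · simp [h, h.not_gt]
  have hcomm : ∑ p : ι × ι, (if p.2 < p.1 then f p else 0) =
      ∑ p : ι × ι, (if p.1 < p.2 then f p else 0) :=
    Fintype.sum_equiv (Equiv.prodComm ι ι) _ _ fun p => by simp [hswap]
  rw [Finset.sum_congr rfl fun p _ => hsplit p, Finset.sum_add_distrib, hcomm, two_mul,
    Finset.sum_filter]

/-- For a diagonal matrix `A = diagonal a` with unit entries, a matrix `X` with
`X * A + A * Xᵀ = 0` has zero diagonal, satisfies `X j i = -(a j / a i) * X i j`,
and `trace (X * X) = -2 * ∑_{i < j} (a j / a i) * (X i j)^2`. -/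
theorem stabilizer_killing_form_diagonalization {k : Type*} [Field k]
    (h2 : (2 : k) ≠ 0) (n : ℕ) (a : Fin n → kˣ)
    (X : Matrix (Fin n) (Fin n) k)
    (hX : X * Matrix.diagonal (fun i => (a i : k)) +
          Matrix.diagonal (fun i => (a i : k)) * Xᵀ = 0) :
    (∀ i, X i i = 0) ∧
    (∀ i j, X j i = -((a j : k) / (a i : k)) * X i j) ∧
    Matrix.trace (X * X) =
      -2 * ∑ ij ∈ Finset.univ.filter (fun ij : Fin n × Fin n => ij.1 < ij.2),
        ((a ij.2 : k) / (a ij.1 : k)) * (X ij.1 ij.2) ^ 2 := by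
  have hentry : ∀ i j, X i j * a j + a i * X j i = 0 := fun i j => by
    simpa [Matrix.mul_diagonal, Matrix.diagonal_mul] using congrFun (congrFun hX i) j
  have hdiag : ∀ i, X i i = 0 := fun i => by
    have h : (2 * (a i : k)) * X i i = 0 := by linear_combination hentry i i
    exact (mul_eq_zero.mp h).resolve_left (mul_ne_zero h2 (a i).ne_zero)
  have hanti : ∀ i j, X j i = -((a j : k) / (a i : k)) * X i j := fun i j => by
    have hi : (a i : k) ≠ 0 := (a i).ne_zero
    field_simp
    linear_combination hentry i j
  refine ⟨hdiag, hanti, ?_⟩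
  have htrace : Matrix.trace (X * X) = ∑ p : Fin n × Fin n, X p.1 p.2 * X p.2 p.1 := by
    simp [Matrix.trace, Matrix.mul_apply, Fintype.sum_prod_type]
  rw [htrace, sum_prod_eq_two_mul_sum_lt _ (by simp [hdiag]) fun p => mul_comm _ _, neg_mul,
    ← mul_neg, ← Finset.sum_neg_distrib]
  congr 1
  refine Finset.sum_congr rfl fun p _ => ?_
  rw [hanti p.1 p.2]
  ring
end

section
/- Let n be a positive natural number and let A, A' be real symmetric n×n matrices with det A = det A' and det A ≠ 0. For an n×n real symmetric invertible matrix M, let q_M denote the quadratic form v ↦ vᵀMv on ℝⁿ, let 𝔥_M = {X ∈ Matrix n n ℝ : X·M + M·Xᵀ = 0} (a linear subspace of the trace-zero matrices), and let Q_M be the quadratic form X ↦ trace(X·X) on 𝔥_M. For a real quadratic form q on a finite-dimensional real vector space, let i(q) denote its negative index (the maximal dimension of a subspace on which q is negative definite), and set ε(q) = (-1)^{i(q)(i(q)-1)/2}. Then ε(Q_A)·ε(Q_{A'}) = (ε(q_A)·ε(q_{A'}))ⁿ. -/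
open Matrix

/-- The negative index of a real quadratic form (given as a function): the maximal
dimension of a subspace on which it is negative definite. -/
noncomputable def negIndex {V : Type*} [AddCommGroup V] [Module ℝ V] (q : V → ℝ) : ℕ :=
  sSup {d : ℕ | ∃ W : Submodule ℝ V, Module.finrank ℝ W = d ∧ ∀ v ∈ W, v ≠ 0 → q v < 0}

/-- The sign `ε(q) = (-1)^(i(q)(i(q)-1)/2)` where `i(q)` is the negative index. -/
noncomputable def epsSign {V : Type*} [AddCommGroup V] [Module ℝ V] (q : V → ℝ) : ℤ :=
  (-1) ^ (negIndex q * (negIndex q - 1) / 2)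

/-- The stabilizer subalgebra `𝔥_M = {X | X*M + M*Xᵀ = 0}` of a symmetric matrix `M`. -/
def stabAlg {n : ℕ} (M : Matrix (Fin n) (Fin n) ℝ) :
    Submodule ℝ (Matrix (Fin n) (Fin n) ℝ) where
  carrier := {X | X * M + M * Xᵀ = 0}
  zero_mem' := by simp
  add_mem' := by
    intro X Y hX hY
    simp only [Set.mem_setOf_eq] at hX hY ⊢
    rw [Matrix.transpose_add, Matrix.add_mul, Matrix.mul_add]
    calc X * M + Y * M + (M * Xᵀ + M * Yᵀ)
        = (X * M + M * Xᵀ) + (Y * M + M * Yᵀ) := by abel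
      _ = 0 := by rw [hX, hY, add_zero]
  smul_mem' := by
    intro c X hX
    simp only [Set.mem_setOf_eq] at hX ⊢
    rw [Matrix.transpose_smul, Matrix.smul_mul, Matrix.mul_smul, ← smul_add, hX, smul_zero]

open QuadraticMap in
/-- The negative index of a form that is diagonal in some linear coordinates is the number of
negative weights. -/
theorem negIndex_eq_ncard {V ι : Type*} [AddCommGroup V] [Module ℝ V] [Fintype ι]
    (q : V → ℝ) (w : ι → ℝ) (e : V ≃ₗ[ℝ] (ι → ℝ)) (h : ∀ v, q v = ∑ i, w i * e v i ^ 2) :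
    negIndex q = {i | w i < 0}.ncard := by
  have : Module.Finite ℝ V := Module.Finite.equiv e.symm
  let Q : QuadraticForm ℝ V := (weightedSumSquares ℝ w).comp e.toLinearMap
  have hQ : ∀ v, Q v = q v := fun v => by
    simp [Q, weightedSumSquares_apply, h, _root_.sq]
  have hsig : sigNeg Q = {i | w i < 0}.ncard :=
    QuadraticForm.sigNeg_of_equiv_weightedSumSquares ⟨⟨e, fun _ => rfl⟩⟩
  rw [← hsig, negIndex, ← (sigNeg_isGreatest Q).csSup_eq]
  congr 1
  ext d
  simp only [Set.mem_ofPred_eq]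
  refine exists_congr fun W => and_congr_right fun _ => ?_
  simp [QuadraticMap.PosDef, hQ]

/-- A real symmetric matrix is orthogonally diagonalizable. -/
theorem Matrix.IsSymm.exists_eq_conj_diagonal {ι : Type*} [Fintype ι] [DecidableEq ι]
    {A : Matrix ι ι ℝ} (hA : A.IsSymm) :
    ∃ (l : ι → ℝ) (U : Matrix ι ι ℝ), Uᵀ * U = 1 ∧ U * Uᵀ = 1 ∧ A = U * diagonal l * Uᵀ := by
  have hH : A.IsHermitian := by simpa [Matrix.IsHermitian, conjTranspose_eq_transpose_of_trivial]
  refine ⟨hH.eigenvalues, hH.eigenvectorUnitary, ?_, ?_, ?_⟩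
  · simpa [star_eq_conjTranspose, conjTranspose_eq_transpose_of_trivial] using
      Unitary.coe_star_mul_self hH.eigenvectorUnitary
  · simpa [star_eq_conjTranspose, conjTranspose_eq_transpose_of_trivial] using
      Unitary.coe_mul_star_self hH.eigenvectorUnitary
  · have := hH.spectral_theorem
    rw [Unitary.conjStarAlgAut_apply] at this
    simpa [star_eq_conjTranspose, conjTranspose_eq_transpose_of_trivial, Function.comp_def]
      using this

theorem negIndex_dotProduct_mulVec {ι : Type*} [Fintype ι] [DecidableEq ι]
    {A U : Matrix ι ι ℝ} {l : ι → ℝ} (h₁ : Uᵀ * U = 1) (h₂ : U * Uᵀ = 1)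
    (hA : A = U * diagonal l * Uᵀ) :
    negIndex (fun v : ι → ℝ => v ⬝ᵥ A.mulVec v) = {i | l i < 0}.ncard := by
  let e : (ι → ℝ) ≃ₗ[ℝ] (ι → ℝ) := Matrix.toLin'OfInv h₂ h₁
  refine negIndex_eq_ncard _ l e fun v => ?_
  have he : e v = Uᵀ *ᵥ v := Matrix.toLin'_apply _ _
  rw [he, hA, ← mulVec_mulVec, ← mulVec_mulVec, dotProduct_mulVec, ← mulVec_transpose]
  simp only [dotProduct, mulVec_diagonal]
  exact Finset.sum_congr rfl fun i _ => by ring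

/-- The skew-symmetric matrix with prescribed entries above the diagonal. -/
def skewOfUpper {n : ℕ} (f : {p : Fin n × Fin n // p.1 < p.2} → ℝ) : Matrix (Fin n) (Fin n) ℝ :=
  fun i j => if h : i < j then f ⟨(i, j), h⟩ else if h : j < i then -f ⟨(j, i), h⟩ else 0

theorem transpose_skewOfUpper {n : ℕ} (f : {p : Fin n × Fin n // p.1 < p.2} → ℝ) :
    (skewOfUpper f)ᵀ = -skewOfUpper f := by
  ext i j
  simp only [transpose_apply, Matrix.neg_apply, skewOfUpper]
  rcases lt_trichotomy i j with h | h | h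
  · simp [h, h.not_gt]
  · simp [h]
  · simp [h, h.not_gt]

theorem skewOfUpper_upper {n : ℕ} {Z : Matrix (Fin n) (Fin n) ℝ} (hZ : Zᵀ = -Z) :
    skewOfUpper (fun p => Z p.1.1 p.1.2) = Z := by
  ext i j
  have hij : Z j i = -Z i j := congr_fun (congr_fun hZ i) j
  simp only [skewOfUpper]
  rcases lt_trichotomy i j with h | h | h
  · simp [h]
  · subst h
    simp only [lt_irrefl, dite_false]
    linarith
  · simp [h, h.not_gt, hij]

theorem upper_skewOfUpper {n : ℕ} (f : {p : Fin n × Fin n // p.1 < p.2} → ℝ) :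
    (fun p : {p : Fin n × Fin n // p.1 < p.2} => skewOfUpper f p.1.1 p.1.2) = f := by
  ext p
  simp [skewOfUpper, p.2]

theorem sum_sum_eq_two_mul_sum_lt_add {R : Type*} [CommSemiring R] {n : ℕ}
    (g : Fin n → Fin n → R) (hg : ∀ i j, g i j = g j i) :
    ∑ i, ∑ j, g i j =
      2 * ∑ p : {p : Fin n × Fin n // p.1 < p.2}, g p.1.1 p.1.2 + ∑ i, g i i := by
  have key : ∀ i j, g i j = (if i < j then g i j else 0) + (if j < i then g j i else 0) +
      (if i = j then g i i else 0) := by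
    intro i j
    rcases lt_trichotomy i j with h | h | h
    · simp [h, h.not_gt, h.ne]
    · simp [h]
    · simp [h, h.not_gt, h.ne', hg i j]
  have hlt : ∑ p : {p : Fin n × Fin n // p.1 < p.2}, g p.1.1 p.1.2 =
      ∑ i, ∑ j, if i < j then g i j else 0 := by
    rw [← Fintype.sum_prod_type' (f := fun i j => if i < j then g i j else 0),
      ← Finset.sum_filter]
    exact (Finset.sum_subtype _ (by simp) (fun p : Fin n × Fin n => g p.1 p.2)).symm
  have hgt : (∑ i, ∑ j, if j < i then g j i else 0) = ∑ i, ∑ j, if i < j then g i j else 0 :=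
    Finset.sum_comm
  calc ∑ i, ∑ j, g i j = ∑ i, ∑ j, ((if i < j then g i j else 0) +
        (if j < i then g j i else 0) + (if i = j then g i i else 0)) :=
        Finset.sum_congr rfl fun i _ => Finset.sum_congr rfl fun j _ => key i j
    _ = _ := by
      simp only [Finset.sum_add_distrib, hgt, hlt, Finset.sum_ite_eq, Finset.mem_univ, if_true]
      ring

section Diagonalized

variable {n : ℕ} {A U : Matrix (Fin n) (Fin n) ℝ} {l : Fin n → ℝ}

/-- In an orthonormal eigenbasis of `A`, an element `X` of `𝔥_A` is determined by the entries of the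
skew-symmetric matrix `X * A` above the diagonal. -/
noncomputable def stabAlgEquivUpper (hS : A.IsSymm) (hl : ∀ i, l i ≠ 0) (h₁ : Uᵀ * U = 1)
    (h₂ : U * Uᵀ = 1) (hA : A = U * diagonal l * Uᵀ) :
    stabAlg A ≃ₗ[ℝ] ({p : Fin n × Fin n // p.1 < p.2} → ℝ) :=
  have hinv : diagonal l * diagonal (fun i => (l i)⁻¹) = 1 := by
    simp [diagonal_mul_diagonal, hl]
  have hinv' : diagonal (fun i => (l i)⁻¹) * diagonal l = 1 := by
    simp [diagonal_mul_diagonal, hl]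
  have hAW : A * (U * diagonal (fun i => (l i)⁻¹) * Uᵀ) = 1 := by
    calc _ = U * (diagonal l * ((Uᵀ * U) * diagonal (fun i => (l i)⁻¹))) * Uᵀ := by
          rw [hA]; noncomm_ring
      _ = 1 := by rw [h₁, one_mul, hinv, mul_one, h₂]
  have hWA : (U * diagonal (fun i => (l i)⁻¹) * Uᵀ) * A = 1 := mul_eq_one_comm.mp hAW
  { toFun := fun X p => (Uᵀ * (X.1 * A) * U) p.1.1 p.1.2
    map_add' := fun X Y => by
      ext p
      simp [Matrix.add_mul, Matrix.mul_add]
    map_smul' := fun c X => by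
      ext p
      simp
    invFun := fun f => ⟨U * skewOfUpper f * Uᵀ * (U * diagonal (fun i => (l i)⁻¹) * Uᵀ), by
      change _ * A + A * _ = 0
      have hW : (U * diagonal (fun i => (l i)⁻¹) * Uᵀ)ᵀ =
          U * diagonal (fun i => (l i)⁻¹) * Uᵀ := by
        simp [transpose_mul, Matrix.mul_assoc]
      rw [transpose_mul, hW, Matrix.mul_assoc _ _ A, hWA, ← Matrix.mul_assoc A, hAW]
      simp [transpose_mul, transpose_skewOfUpper, Matrix.mul_assoc]⟩
    left_inv := fun X => by
      have hX : X.1 * A + A * X.1ᵀ = 0 := X.2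
      have hskew : (Uᵀ * (X.1 * A) * U)ᵀ = -(Uᵀ * (X.1 * A) * U) := by
        have : A * X.1ᵀ = -(X.1 * A) := eq_neg_of_add_eq_zero_right hX
        simp only [transpose_mul, transpose_transpose, hS.eq, this]
        noncomm_ring
      apply Subtype.ext
      change U * skewOfUpper (fun p => (Uᵀ * (X.1 * A) * U) p.1.1 p.1.2) * Uᵀ * _ = X.1
      rw [skewOfUpper_upper hskew]
      calc _ = (U * Uᵀ) * X.1 * A * (U * Uᵀ) * (U * diagonal (fun i => (l i)⁻¹) * Uᵀ) := by
            noncomm_ring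
        _ = X.1 := by rw [h₂, one_mul, mul_one, Matrix.mul_assoc, hAW, mul_one]
    right_inv := fun f => by
      have : Uᵀ * (U * skewOfUpper f * Uᵀ * (U * diagonal (fun i => (l i)⁻¹) * Uᵀ) * A) * U =
          skewOfUpper f := by
        rw [Matrix.mul_assoc _ _ A, hWA]
        calc _ = (Uᵀ * U) * skewOfUpper f * (Uᵀ * U) := by noncomm_ring
          _ = _ := by rw [h₁, one_mul, mul_one]
      conv_rhs => rw [← upper_skewOfUpper f, ← this] }

theorem trace_mul_self_stabAlg (hS : A.IsSymm) (hl : ∀ i, l i ≠ 0) (h₁ : Uᵀ * U = 1)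
    (h₂ : U * Uᵀ = 1) (hA : A = U * diagonal l * Uᵀ) (X : stabAlg A) :
    trace (X.1 * X.1) = ∑ p : {p : Fin n × Fin n // p.1 < p.2},
      (-2 * (l p.1.1 * l p.1.2)⁻¹) * stabAlgEquivUpper hS hl h₁ h₂ hA X p ^ 2 := by
  set Z := Uᵀ * (X.1 * A) * U with hZ
  have happ : ∀ p, stabAlgEquivUpper hS hl h₁ h₂ hA X p = Z p.1.1 p.1.2 := fun p => rfl
  have hY : Z = (Uᵀ * X.1 * U) * diagonal l := by
    calc Z = Uᵀ * X.1 * U * diagonal l * (Uᵀ * U) := by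
          have hXA : X.1 * A = X.1 * (U * diagonal l * Uᵀ) := congrArg (X.1 * ·) hA
          rw [hZ, hXA]
          noncomm_ring
      _ = _ := by rw [h₁, mul_one]
  have hYZ : ∀ i j, (Uᵀ * X.1 * U) i j = Z i j * (l j)⁻¹ := fun i j => by
    rw [hY, mul_diagonal, mul_inv_cancel_right₀ (hl j)]
  have hskew : ∀ i j, Z j i = -Z i j := by
    have hX : A * X.1ᵀ = -(X.1 * A) := eq_neg_of_add_eq_zero_right X.2
    have : Zᵀ = -Z := by
      simp only [hZ, transpose_mul, transpose_transpose, hS.eq, hX]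
      noncomm_ring
    exact fun i j => congr_fun (congr_fun this i) j
  have htr : trace (X.1 * X.1) = trace ((Uᵀ * X.1 * U) * (Uᵀ * X.1 * U)) := by
    calc trace (X.1 * X.1) = trace ((X.1 * X.1) * (U * Uᵀ)) := by rw [h₂, mul_one]
      _ = trace (X.1 * (U * Uᵀ) * X.1 * U * Uᵀ) := by rw [h₂, mul_one, mul_one, mul_assoc _ U, h₂, mul_one]
      _ = trace (Uᵀ * (X.1 * (U * Uᵀ) * X.1 * U)) := trace_mul_comm _ _
      _ = _ := by congr 1; noncomm_ring
  have hsum : trace (X.1 * X.1) = ∑ i, ∑ j, -(l i * l j)⁻¹ * Z i j ^ 2 := by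
    rw [htr]
    simp only [trace, diag_apply, mul_apply (M := Uᵀ * X.1 * U), hYZ]
    refine Finset.sum_congr rfl fun i _ => Finset.sum_congr rfl fun j _ => ?_
    rw [hskew i j, mul_inv]
    ring
  have hdiag : ∀ i, Z i i = 0 := fun i => by linarith [hskew i i]
  rw [hsum, sum_sum_eq_two_mul_sum_lt_add _ fun i j => by rw [hskew i j, mul_comm (l i)]; ring]
  simp only [hdiag, happ, Finset.mul_sum]
  simp [mul_assoc]

theorem negIndex_trace_stabAlg (hS : A.IsSymm) (hl : ∀ i, l i ≠ 0) (h₁ : Uᵀ * U = 1)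
    (h₂ : U * Uᵀ = 1) (hA : A = U * diagonal l * Uᵀ) :
    2 * negIndex (fun X : stabAlg A => trace (X.1 * X.1)) + n =
      {i | l i < 0}.ncard ^ 2 + {i | 0 < l i}.ncard ^ 2 := by
  rw [negIndex_eq_ncard _ _ _ (trace_mul_self_stabAlg hS hl h₁ h₂ hA)]
  have hcard : ∀ {κ : Type} [Fintype κ] (P : κ → Prop) [DecidablePred P],
      {i | P i}.ncard = ∑ i, if P i then 1 else 0 := fun P _ => by
    simp [Set.ncard_eq_toFinset_card']
  have hsum := sum_sum_eq_two_mul_sum_lt_add (fun i j => if 0 < l i * l j then 1 else 0)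
    fun i j => by simp only [mul_comm]
  have hiff : ∀ p : {p : Fin n × Fin n // p.1 < p.2},
      -2 * (l p.1.1 * l p.1.2)⁻¹ < 0 ↔ 0 < l p.1.1 * l p.1.2 := fun p => by
    rw [← inv_pos (a := l p.1.1 * l p.1.2)]
    constructor <;> intro h <;> linarith
  have hn : (∑ i, if 0 < l i * l i then 1 else 0) = n := by
    simp [mul_self_pos, hl]
  simp only [hiff, hcard]
  rw [hn] at hsum
  rw [← hsum, sq, sq, Finset.sum_mul_sum, Finset.sum_mul_sum, ← Finset.sum_add_distrib]
  refine Finset.sum_congr rfl fun i _ => ?_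
  rw [← Finset.sum_add_distrib]
  refine Finset.sum_congr rfl fun j _ => ?_
  rcases (hl i).lt_or_gt with hi | hi <;> rcases (hl j).lt_or_gt with hj | hj
  · simp [hi, hj, hi.not_gt, mul_pos_of_neg_of_neg hi hj]
  · simp [hi, hj, hi.not_gt, hj.not_gt, (mul_neg_of_neg_of_pos hi hj).not_gt]
  · simp [hi, hj, hi.not_gt, hj.not_gt, (mul_neg_of_pos_of_neg hi hj).not_gt]
  · simp [hi, hj, hi.not_gt, mul_pos hi hj]

end Diagonalized

theorem neg_one_pow_ncard_mul_prod_pos {ι : Type*} [Fintype ι] (l : ι → ℝ)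
    (hl : ∀ i, l i ≠ 0) : 0 < (-1) ^ {i | l i < 0}.ncard * ∏ i, l i := by
  classical
  have : (-1 : ℝ) ^ {i | l i < 0}.ncard = ∏ i, if l i < 0 then -1 else 1 := by
    rw [Finset.prod_ite]
    simp [Set.ncard_eq_toFinset_card']
  rw [this, ← Finset.prod_mul_distrib]
  refine Finset.prod_pos fun i _ => ?_
  rcases (hl i).lt_or_gt with h | h
  · simp [h]
  · simp [h, h.not_gt]

/-- The invariants of a nondegenerate symmetric matrix: with `q` the negative index of `q_A`, the
negative index of `Q_A` is `(q ^ 2 + (n - q) ^ 2 - n) / 2`, and the sign of `det A` is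
`(-1) ^ q`. -/
theorem exists_negIndex_data {n : ℕ} {A : Matrix (Fin n) (Fin n) ℝ} (hS : A.IsSymm)
    (hne : A.det ≠ 0) :
    ∃ p : ℕ, negIndex (fun v : Fin n → ℝ => v ⬝ᵥ A.mulVec v) + p = n ∧
      2 * negIndex (fun X : stabAlg A => trace (X.1 * X.1)) + n =
        negIndex (fun v : Fin n → ℝ => v ⬝ᵥ A.mulVec v) ^ 2 + p ^ 2 ∧
      0 < (-1) ^ negIndex (fun v : Fin n → ℝ => v ⬝ᵥ A.mulVec v) * A.det := by
  obtain ⟨l, U, h₁, h₂, hA⟩ := hS.exists_eq_conj_diagonal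
  have hdet : A.det = ∏ i, l i := by
    have hU : U.det * Uᵀ.det = 1 := by rw [← det_mul, h₂, det_one]
    rw [hA, det_mul, det_mul, mul_right_comm, hU, one_mul, det_diagonal]
  have hl : ∀ i, l i ≠ 0 := fun i hi =>
    hne (hdet.trans (Finset.prod_eq_zero (Finset.mem_univ i) hi))
  rw [negIndex_dotProduct_mulVec h₁ h₂ hA, hdet]
  refine ⟨{i | 0 < l i}.ncard, ?_, negIndex_trace_stabAlg hS hl h₁ h₂ hA,
    neg_one_pow_ncard_mul_prod_pos l hl⟩
  have hc : {i | 0 < l i} = {i | l i < 0}ᶜ := by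
    ext i
    simpa using (show 0 < l i ↔ 0 ≤ l i from (hl i).symm.le_iff_lt.symm)
  rw [hc, Set.ncard_add_ncard_compl]
  simp

/-- The parity comparison behind the sign formula, for negative indices `q ≡ q'` modulo `2`. -/
theorem neg_one_pow_triangle_identity {n p q p' q' I I' : ℕ} (hpq : q + p = n)
    (hpq' : q' + p' = n) (hI : 2 * I + n = q ^ 2 + p ^ 2) (hI' : 2 * I' + n = q' ^ 2 + p' ^ 2)
    (hq : Even q ↔ Even q') :
    (-1 : ℤ) ^ (I * (I - 1) / 2) * (-1) ^ (I' * (I' - 1) / 2) =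
      ((-1) ^ (q * (q - 1) / 2) * (-1) ^ (q' * (q' - 1) / 2)) ^ n := by
  have tri : ∀ m : ℕ, 2 * ((m * (m - 1) / 2 : ℕ) : ℤ) = m ^ 2 - m := fun m => by
    have h := Nat.two_mul_div_two_of_even (Nat.even_mul_pred_self m)
    rw [← Nat.cast_two, ← Nat.cast_mul, h]
    rcases m with _ | m
    · simp
    · push_cast [Nat.add_sub_cancel]
      ring
  have tI := tri I
  have tI' := tri I'
  have tq := tri q
  have tq' := tri q'
  generalize I * (I - 1) / 2 = a at *
  generalize I' * (I' - 1) / 2 = a' at *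
  generalize q * (q - 1) / 2 = b at *
  generalize q' * (q' - 1) / 2 = b' at *
  rw [← pow_add, ← pow_add, ← pow_mul]
  apply neg_one_pow_congr
  rw [← Int.even_coe_nat, ← Int.even_coe_nat, ← Int.even_sub]
  obtain ⟨k, hk⟩ : ∃ k : ℤ, (q' : ℤ) = q + 2 * k := by
    have : Even ((q' : ℤ) - q) := by
      rw [Int.even_sub, Int.even_coe_nat, Int.even_coe_nat]
      exact hq.symm
    obtain ⟨k, hk⟩ := this
    exact ⟨k, by linarith⟩
  zify at hpq hpq' hI hI'
  have hp : (p : ℤ) = n - q := by linarith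
  have hp' : (p' : ℤ) = n - q - 2 * k := by linarith
  obtain ⟨m, hm⟩ : ∃ m : ℤ, m = 2 * k * q + 2 * k ^ 2 - k * n := ⟨_, rfl⟩
  have hII : (I' : ℤ) = I + 2 * m := by
    rw [hp] at hI
    rw [hk, hp'] at hI'
    rw [hm]
    linarith
  have hb : (b' : ℤ) = b + 2 * k * q + 2 * k ^ 2 - k := by
    rw [hk] at tq'
    linarith
  have ha : (a' : ℤ) = a + 2 * m * I + 2 * m ^ 2 - m := by
    rw [hII] at tI'
    linarith
  push_cast
  rw [ha, hb]
  refine ⟨a + m * I + m ^ 2 - n * (b + k * q + k ^ 2) + (n * k - k * q - k ^ 2), ?_⟩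
  linear_combination -hm

/-- For real symmetric `n × n` matrices `A, A'` with equal nonzero determinant,
`ε(Q_A) · ε(Q_{A'}) = (ε(q_A) · ε(q_{A'}))ⁿ`, where `q_M (v) = vᵀ M v` and `Q_M` is
the form `X ↦ trace (X * X)` on the stabilizer subalgebra `𝔥_M`. -/
theorem sign_function_symmetric_matrices (n : ℕ) (hn : 0 < n)
    (A A' : Matrix (Fin n) (Fin n) ℝ) (hA : A.IsSymm) (hA' : A'.IsSymm)
    (hdet : A.det = A'.det) (hne : A.det ≠ 0) :
    epsSign (fun X : stabAlg A => Matrix.trace ((X : Matrix (Fin n) (Fin n) ℝ) * (X : Matrix (Fin n) (Fin n) ℝ))) *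
    epsSign (fun X : stabAlg A' => Matrix.trace ((X : Matrix (Fin n) (Fin n) ℝ) * (X : Matrix (Fin n) (Fin n) ℝ))) =
    (epsSign (fun v : Fin n → ℝ => v ⬝ᵥ A.mulVec v) *
     epsSign (fun v : Fin n → ℝ => v ⬝ᵥ A'.mulVec v)) ^ n := by
  obtain ⟨p, hp, hI, hd⟩ := exists_negIndex_data hA hne
  obtain ⟨p', hp', hI', hd'⟩ := exists_negIndex_data hA' (hdet ▸ hne)
  refine neg_one_pow_triangle_identity hp hp' hI hI' ?_
  rw [← hdet] at hd'
  have key := mul_pos hd hd'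
  rw [mul_mul_mul_comm, ← pow_add] at key
  rw [← Nat.even_add]
  by_contra hodd
  rw [(Nat.not_even_iff_odd.mp hodd).neg_one_pow] at key
  linarith [mul_self_nonneg A.det]
end

section
/- For all natural numbers n, j with j ≤ n and every complex number s: ∑_{ε} ( ∏_{k=1}^{n} ε_k ) · exp( (π·i/2)·( ∑_{k=1}^{j} (k+s)·ε_k − ∑_{k=j+1}^{n} (k−j+s)·ε_k ) ) = (2i)ⁿ · (−1)^{n−j} · ( ∏_{k=1}^{j} sin(π(k+s)/2) ) · ( ∏_{k=1}^{n−j} sin(π(k+s)/2) ), where the sum ranges over all 2ⁿ sign vectors ε = (ε_1, …, ε_n) with each ε_k ∈ {+1, −1}. -/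
open Finset

/-- Summing `∏ ε_k · exp(i ∑ a_k ε_k)` over all sign vectors factors into a product of sines. -/
theorem sum_signs_mul_exp {ι : Type*} [Fintype ι] [DecidableEq ι] (a : ι → ℂ) :
    ∑ ε : ι → ℤˣ, (∏ k, ((ε k : ℤ) : ℂ)) *
        Complex.exp (∑ k, a k * Complex.I * ((ε k : ℤ) : ℂ)) =
      (2 * Complex.I) ^ Fintype.card ι * ∏ k, Complex.sin (a k) := by
  have h (k : ι) : ∑ u : ℤˣ, ((u : ℤ) : ℂ) * Complex.exp (a k * Complex.I * ((u : ℤ) : ℂ)) =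
      2 * Complex.I * Complex.sin (a k) := by
    rw [mul_right_comm, Complex.two_sin, mul_assoc, Complex.I_mul_I]
    simp
    ring
  calc _ = ∏ k, ∑ u : ℤˣ, ((u : ℤ) : ℂ) * Complex.exp (a k * Complex.I * ((u : ℤ) : ℂ)) := by
        rw [Finset.prod_univ_sum, Fintype.piFinset_univ]
        simp only [Complex.exp_sum, Finset.prod_mul_distrib]
    _ = _ := by
        simp only [h, Finset.prod_mul_distrib, Finset.prod_const, Finset.card_univ, mul_pow]

/-- Signed column sums of Shintani's Γ-matrix:
`∑_ε (∏_k ε_k) exp((πi/2)(∑_{k≤j}(k+s)ε_k − ∑_{k>j}(k−j+s)ε_k))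
  = (2i)ⁿ (−1)^{n−j} ∏_{k=1}^{j} sin(π(k+s)/2) ∏_{k=1}^{n−j} sin(π(k+s)/2)`,
the sum being over all sign vectors `ε : Fin n → ℤˣ` (i.e. each `ε_k ∈ {±1}`). -/
theorem shintani_column_sums_sin (n j : ℕ) (hj : j ≤ n) (s : ℂ) :
    ∑ ε : Fin n → ℤˣ,
      (∏ k : Fin n, ((ε k : ℤ) : ℂ)) *
      Complex.exp ((Real.pi : ℂ) * Complex.I / 2 *
        ((∑ k ∈ Finset.univ.filter (fun k : Fin n => (k : ℕ) + 1 ≤ j),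
            (((k : ℕ) + 1 : ℂ) + s) * ((ε k : ℤ) : ℂ)) -
         (∑ k ∈ Finset.univ.filter (fun k : Fin n => j < (k : ℕ) + 1),
            (((k : ℕ) + 1 : ℂ) - (j : ℂ) + s) * ((ε k : ℤ) : ℂ)))) =
    (2 * Complex.I) ^ n * (-1 : ℂ) ^ (n - j) *
      (∏ k ∈ Finset.Icc 1 j, Complex.sin ((Real.pi : ℂ) * ((k : ℂ) + s) / 2)) *
      (∏ k ∈ Finset.Icc 1 (n - j), Complex.sin ((Real.pi : ℂ) * ((k : ℂ) + s) / 2)) := by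
  obtain ⟨m, rfl⟩ := Nat.exists_eq_add_of_le hj
  let a : Fin (j + m) → ℂ := fun k =>
    if (k : ℕ) + 1 ≤ j then Real.pi * ((((k : ℕ) + 1 : ℂ)) + s) / 2
    else -(Real.pi * ((((k : ℕ) + 1 : ℂ)) - j + s) / 2)
  have hexp (ε : Fin (j + m) → ℤˣ) :
      (Real.pi : ℂ) * Complex.I / 2 *
        ((∑ k ∈ Finset.univ.filter (fun k : Fin (j + m) => (k : ℕ) + 1 ≤ j),
            (((k : ℕ) + 1 : ℂ) + s) * ((ε k : ℤ) : ℂ)) -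
         (∑ k ∈ Finset.univ.filter (fun k : Fin (j + m) => j < (k : ℕ) + 1),
            (((k : ℕ) + 1 : ℂ) - (j : ℂ) + s) * ((ε k : ℤ) : ℂ))) =
      ∑ k, a k * Complex.I * ((ε k : ℤ) : ℂ) := by
    rw [Finset.sum_filter, Finset.sum_filter, ← Finset.sum_sub_distrib, Finset.mul_sum]
    refine Finset.sum_congr rfl fun k _ => ?_
    by_cases hk : (k : ℕ) + 1 ≤ j
    · simp only [a, hk, if_true, not_lt.mpr hk, if_false]
      ring
    · simp only [a, hk, if_false, not_le.mp hk, if_true]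
      ring
  have hIcc (p : ℕ) : ∏ k ∈ Finset.Icc 1 p, Complex.sin ((Real.pi : ℂ) * ((k : ℂ) + s) / 2) =
      ∏ k : Fin p, Complex.sin ((Real.pi : ℂ) * (((k : ℕ) + 1 : ℂ) + s) / 2) := by
    rw [← Finset.Ico_add_one_right_eq_Icc, Finset.prod_Ico_eq_prod_range, Finset.prod_range]
    simp [add_comm]
  have hleft (k : Fin j) :
      a (Fin.castAdd m k) = Real.pi * (((k : ℕ) + 1 : ℂ) + s) / 2 := by
    simp [a]
  have hright (k : Fin m) :
      a (Fin.natAdd j k) = -(Real.pi * (((k : ℕ) + 1 : ℂ) + s) / 2) := by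
    have hk : ¬ j + (k : ℕ) + 1 ≤ j := by omega
    simp only [a, Fin.val_natAdd, hk, if_false]
    push_cast
    ring
  simp only [hexp]
  rw [sum_signs_mul_exp, Fin.prod_univ_add, hIcc, hIcc, Nat.add_sub_cancel_left]
  simp only [hleft, hright, Complex.sin_neg, Finset.prod_neg, Finset.card_univ, Fintype.card_fin]
  ring
end

section
/- Let n be an odd natural number, j a natural number with j ≤ n, and s a complex number. Then ( ∏_{k=1}^{j} cos(π(k+s)/2) ) · ( ∏_{k=1}^{n−j} cos(π(k+s)/2) ) = (−1)^{j(n−j)/2} · ∏_{k=1}^{n} cos(π(k+s)/2). (Note that j(n−j) is even when n is odd, so the exponent j(n−j)/2 is a natural number.) -/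
section Antiperiodic

variable {R : Type*} [CommRing R] {f : ℕ → R}

/-- Shifting a product of two consecutive values of a sequence with `f (k + 2) = -f k` by `l`
multiplies it by `(-1) ^ l`. -/
theorem mul_succ_eq_neg_one_pow_mul_shift (hf : ∀ k, f (k + 2) = -f k) (a l : ℕ) :
    f a * f (a + 1) = (-1) ^ l * (f (a + l) * f (a + l + 1)) := by
  induction l with
  | zero => simp
  | succ l ih =>
    rw [ih, ← add_assoc, show a + l + 1 + 1 = a + l + 2 from rfl, hf, pow_succ]
    ring

theorem prod_Icc_mul_prod_Icc_two_mul (hf : ∀ k, f (k + 2) = -f k) (l m : ℕ) :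
    (∏ k ∈ Finset.Icc 1 l, f k) * ∏ k ∈ Finset.Icc 1 (2 * m), f k =
      (-1) ^ (l * m) * ∏ k ∈ Finset.Icc 1 (l + 2 * m), f k := by
  induction m with
  | zero => simp
  | succ m ih =>
    have h := mul_succ_eq_neg_one_pow_mul_shift hf (2 * m + 1) l
    rw [show 2 * m + 1 + l = l + 2 * m + 1 by ring] at h
    rw [show 2 * (m + 1) = 2 * m + 1 + 1 by ring,
      show l + (2 * m + 1 + 1) = l + 2 * m + 1 + 1 by ring]
    simp only [Finset.prod_Icc_succ_top (Nat.le_add_left 1 _)]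
    rw [mul_add, mul_one, pow_add]
    linear_combination (f (2 * m + 1) * f (2 * m + 1 + 1)) * ih +
      (-1) ^ (l * m) * (∏ k ∈ Finset.Icc 1 (l + 2 * m), f k) * h

end Antiperiodic

theorem cos_pi_mul_add_two_div_two (s : ℂ) (k : ℕ) :
    Complex.cos ((Real.pi : ℂ) * (((k + 2 : ℕ) : ℂ) + s) / 2) =
      -Complex.cos ((Real.pi : ℂ) * ((k : ℂ) + s) / 2) := by
  rw [← Complex.cos_add_pi]
  congr 1
  push_cast
  ring

/-- For odd `n` and `j ≤ n`:
`∏_{k=1}^{j} cos(π(k+s)/2) · ∏_{k=1}^{n−j} cos(π(k+s)/2)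
  = (−1)^{j(n−j)/2} · ∏_{k=1}^{n} cos(π(k+s)/2)`. -/
theorem cos_products_proportional_odd (n j : ℕ) (hodd : Odd n) (hj : j ≤ n) (s : ℂ) :
    (∏ k ∈ Finset.Icc 1 j, Complex.cos ((Real.pi : ℂ) * ((k : ℂ) + s) / 2)) *
    (∏ k ∈ Finset.Icc 1 (n - j), Complex.cos ((Real.pi : ℂ) * ((k : ℂ) + s) / 2)) =
    (-1 : ℂ) ^ (j * (n - j) / 2) *
      ∏ k ∈ Finset.Icc 1 n, Complex.cos ((Real.pi : ℂ) * ((k : ℂ) + s) / 2) := by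
  have hf := cos_pi_mul_add_two_div_two s
  obtain ⟨i, rfl⟩ := Nat.exists_eq_add_of_le hj
  rw [Nat.add_sub_cancel_left]
  rcases Nat.even_or_odd' i with ⟨m, rfl | rfl⟩
  · rw [prod_Icc_mul_prod_Icc_two_mul hf, show j * (2 * m) / 2 = j * m by
      rw [mul_left_comm, Nat.mul_div_cancel_left _ two_pos]]
  · obtain ⟨m', rfl⟩ : ∃ m', j = 2 * m' := by
      obtain ⟨c, hc⟩ := hodd
      exact ⟨c - m, by omega⟩
    rw [mul_comm (∏ k ∈ _, _), prod_Icc_mul_prod_Icc_two_mul hf,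
      show 2 * m' * (2 * m + 1) / 2 = (2 * m + 1) * m' by
        rw [mul_assoc, Nat.mul_div_cancel_left _ two_pos, mul_comm],
      add_comm (2 * m + 1) (2 * m')]
end

section
/- Let n be an odd natural number, j a natural number with j ≤ n, and s a complex number. Then ( ∏_{k=1}^{j} sin(π(k+s)/2) ) · ( ∏_{k=1}^{n−j} sin(π(k+s)/2) ) = (−1)^{j(n−j)/2} · ∏_{k=1}^{n} sin(π(k+s)/2). (Note that j(n−j) is even when n is odd, so the exponent j(n−j)/2 is a natural number.) -/
theorem apply_two_mul_add_of_antiperiodic_two {R : Type*} [CommRing R] {f : ℕ → R}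
    (hf : ∀ k, f (k + 2) = -f k) (m k : ℕ) : f (2 * m + k) = (-1) ^ m * f k := by
  induction m with
  | zero => simp
  | succ m ih =>
    rw [show 2 * (m + 1) + k = 2 * m + k + 2 by ring, hf, ih, pow_succ]
    ring

theorem prod_Icc_mul_prod_Icc_of_antiperiodic_two {R : Type*} [CommRing R] {f : ℕ → R}
    (hf : ∀ k, f (k + 2) = -f k) (m r : ℕ) :
    (∏ k ∈ Finset.Icc 1 (2 * m), f k) * ∏ k ∈ Finset.Icc 1 r, f k =
      (-1) ^ (m * r) * ∏ k ∈ Finset.Icc 1 (2 * m + r), f k := by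
  induction r with
  | zero => simp
  | succ r ih =>
    have hsq : ((-1 : R) ^ m) * (-1) ^ m = 1 := by rw [← mul_pow]; simp
    rw [Finset.prod_Icc_succ_top (by omega), ← mul_assoc, ih, ← add_assoc,
      Finset.prod_Icc_succ_top (by omega), add_assoc,
      apply_two_mul_add_of_antiperiodic_two hf, mul_add_one, pow_add]
    linear_combination (-(-1) ^ (m * r) * (∏ k ∈ Finset.Icc 1 (2 * m + r), f k) * f (r + 1)) * hsq

theorem sin_pi_mul_add_two_div_two (s : ℂ) (k : ℕ) :
    Complex.sin ((Real.pi : ℂ) * (((k + 2 : ℕ) : ℂ) + s) / 2) =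
      -Complex.sin ((Real.pi : ℂ) * ((k : ℂ) + s) / 2) := by
  rw [← Complex.sin_add_pi]
  push_cast
  ring_nf

/-- For odd `n` and `j ≤ n`:
`∏_{k=1}^{j} sin(π(k+s)/2) · ∏_{k=1}^{n−j} sin(π(k+s)/2)
  = (−1)^{j(n−j)/2} · ∏_{k=1}^{n} sin(π(k+s)/2)`. -/
theorem sin_products_proportional_odd (n j : ℕ) (hodd : Odd n) (hj : j ≤ n) (s : ℂ) :
    (∏ k ∈ Finset.Icc 1 j, Complex.sin ((Real.pi : ℂ) * ((k : ℂ) + s) / 2)) *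
    (∏ k ∈ Finset.Icc 1 (n - j), Complex.sin ((Real.pi : ℂ) * ((k : ℂ) + s) / 2)) =
    (-1 : ℂ) ^ (j * (n - j) / 2) *
      ∏ k ∈ Finset.Icc 1 n, Complex.sin ((Real.pi : ℂ) * ((k : ℂ) + s) / 2) := by
  have hf := sin_pi_mul_add_two_div_two s
  obtain ⟨r, rfl⟩ := Nat.exists_eq_add_of_le hj
  rw [Nat.add_sub_cancel_left]
  rcases Nat.even_or_odd' j with ⟨m, rfl | rfl⟩
  · rw [mul_assoc, Nat.mul_div_cancel_left _ two_pos]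
    exact prod_Icc_mul_prod_Icc_of_antiperiodic_two hf m r
  · obtain ⟨m', rfl⟩ : ∃ m', r = 2 * m' := by
      obtain ⟨c, hc⟩ := hodd
      exact ⟨c - m, by omega⟩
    rw [mul_comm (2 * m + 1) (2 * m'), mul_assoc, Nat.mul_div_cancel_left _ two_pos,
      add_comm (2 * m + 1) (2 * m'), mul_comm (∏ k ∈ _, _)]
    exact prod_Icc_mul_prod_Icc_of_antiperiodic_two hf m' (2 * m + 1)
end

section
/- Fix a prime p. Let N and n be natural numbers, r > 0, and B = the open ball of radius r centered at 0 in the space V = Fin N → ℚ_p. Let f : Fin n → (V → ℚ_p) be a family of functions each of which is analytic on B, such that the differentials at zero, fderiv ℚ_p (f i) 0 for i = 1,…,n, are linearly independent over ℚ_p. Let ψ : ℚ_p → ℂ be a continuous nontrivial additive character. Then there exist a ∈ ℚ_pˣ and T > 0 such that for every t ∈ ℚ_pˣ with ‖t‖ ≥ T, the n functions x ↦ ψ(t·(f i)(x)), restricted to the set (t⁻¹·a)·B (the ball of radius ‖t⁻¹a‖·r centered at 0), are linearly independent over ℂ. -/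
open Pointwise
open Filter Topology

/-- A finite linearly independent family of functions stays linearly independent after restriction
to suitably chosen finitely many points. -/
theorem LinearIndependent.exists_linearIndependent_comp {K X : Type*} [Field K] {n : ℕ}
    {g : Fin n → X → K} (hg : LinearIndependent K g) :
    ∃ y : Fin n → X, LinearIndependent K fun i j => g i (y j) := by
  have hspan : Submodule.span K (Set.range fun x i => g i x) = ⊤ :=
    span_flip_eq_top_iff_linearIndependent.mpr hg
  obtain ⟨h, hmem, -, hli⟩ :=
    Submodule.exists_fun_fin_finrank_span_eq K (Set.range fun x i => g i x)
  have hn : Module.finrank K (Submodule.span K (Set.range fun x i => g i x)) = n := by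
    rw [hspan, finrank_top, Module.finrank_fin_fun]
  choose y hy using hmem
  refine ⟨fun j => y (Fin.cast hn.symm j), ?_⟩
  have hrow : LinearIndependent K (Matrix.of fun j i => g i (y (Fin.cast hn.symm j))).row := by
    have hcomp := hli.comp (Fin.cast hn.symm) (Fin.cast_injective _)
    rwa [show h = fun k i => g i (y k) from funext fun k => (hy k).symm] at hcomp
  exact Matrix.linearIndependent_cols_iff_isUnit.mpr
    (Matrix.linearIndependent_rows_iff_isUnit.mp hrow)

/-- Composing a nontrivial additive character of a field with distinct linear forms yields
linearly independent functions. -/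
theorem AddChar.linearIndependent_comp_linearMap {F V L ι : Type*} [Field F] [AddCommGroup V]
    [Module F V] [CommRing L] [IsDomain L] {ψ : AddChar F L} (hψ : ∃ x, ψ x ≠ 1)
    {ℓ : ι → V →ₗ[F] F} (hℓ : Function.Injective ℓ) :
    LinearIndependent L fun i v => ψ (ℓ i v) := by
  refine (linearIndependent_monoidHom (Multiplicative V) L).comp
    (fun i => (ψ.compAddMonoidHom (ℓ i).toAddMonoidHom).toMonoidHom) fun i j hij => hℓ ?_
  by_contra hne
  obtain ⟨v, hv⟩ : ∃ v, ℓ i v - ℓ j v ≠ 0 := by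
    by_contra! h
    exact hne (LinearMap.ext fun v => sub_eq_zero.mp (h v))
  obtain ⟨x, hx⟩ := hψ
  have key (w : V) : ψ (ℓ i w) = ψ (ℓ j w) := DFunLike.congr_fun hij (Multiplicative.ofAdd w)
  apply hx
  set w := (x / (ℓ i v - ℓ j v)) • v
  have hw : x = ℓ i w - ℓ j w := by
    simp only [w, map_smul, smul_eq_mul, ← mul_sub]
    exact (div_mul_cancel₀ x hv).symm
  rw [hw, sub_eq_add_neg, AddChar.map_add_eq_mul, key, ← AddChar.map_add_eq_mul, add_neg_cancel,
    AddChar.map_zero_eq_one]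

/-- If `f₁, …, fₙ` are analytic on a ball `B` around `0` in `ℚ_pᴺ` with linearly
independent differentials at `0`, then there is `a ∈ ℚ_pˣ` such that for all
`t ∈ ℚ_pˣ` with `‖t‖` large enough, the functions `x ↦ ψ(t · fᵢ(x))` restricted to
`(t⁻¹ a) • B` are linearly independent over ℂ. -/
theorem linearly_independent_characters_of_analytic (p : ℕ) [Fact p.Prime]
    (N n : ℕ) (r : ℝ) (hr : 0 < r)
    (f : Fin n → ((Fin N → ℚ_[p]) → ℚ_[p]))
    (hf : ∀ i, AnalyticOnNhd ℚ_[p] (f i) (Metric.ball (0 : Fin N → ℚ_[p]) r))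
    (hind : LinearIndependent ℚ_[p] (fun i => fderiv ℚ_[p] (f i) 0))
    (ψ : AddChar ℚ_[p] ℂ) (hψc : Continuous ψ) (hψ : ∃ x, ψ x ≠ 1) :
    ∃ (a : ℚ_[p]ˣ) (T : ℝ), 0 < T ∧ ∀ t : ℚ_[p]ˣ, T ≤ ‖(t : ℚ_[p])‖ →
      LinearIndependent ℂ
        (fun i : Fin n =>
          (fun x : ((((t⁻¹ * a : ℚ_[p]ˣ) : ℚ_[p])) • Metric.ball (0 : Fin N → ℚ_[p]) r :
              Set (Fin N → ℚ_[p])) =>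
            ψ ((t : ℚ_[p]) * f i (x : Fin N → ℚ_[p])))) := by
  have hinj : Function.Injective fun i =>
      (fderiv ℚ_[p] (f i) 0 : (Fin N → ℚ_[p]) →ₗ[ℚ_[p]] ℚ_[p]) :=
    ContinuousLinearMap.coe_injective.comp hind.injective
  obtain ⟨y, hy⟩ := (AddChar.linearIndependent_comp_linearMap hψ hinj).exists_linearIndependent_comp
  obtain ⟨a, ha⟩ : ∃ a : ℚ_[p]ˣ, ∀ j, (a : ℚ_[p])⁻¹ • y j ∈ Metric.ball 0 r := by
    have hsmall : ∀ᶠ c : ℚ_[p] in 𝓝[≠] 0, ∀ j, c • y j ∈ Metric.ball 0 r := by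
      refine eventually_all.mpr fun j => Eventually.filter_mono nhdsWithin_le_nhds ?_
      have hc : Continuous fun c : ℚ_[p] => c • y j := by fun_prop
      exact hc.continuousAt.eventually_mem (by simpa using Metric.ball_mem_nhds _ hr)
    obtain ⟨c, hc, hc0⟩ := (hsmall.and eventually_mem_nhdsWithin).exists
    have hne : c ≠ 0 := hc0
    exact ⟨(Units.mk0 c hne)⁻¹, by
      simpa only [Units.val_inv_eq_inv_val, Units.val_mk0, inv_inv] using hc⟩
  have hlim : Tendsto (fun t : ℚ_[p] => fun i j => ψ (t * (f i (t⁻¹ • y j) - f i 0)))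
      (Bornology.cobounded ℚ_[p]) (𝓝 fun i j => ψ (fderiv ℚ_[p] (f i) 0 (y j))) := by
    refine tendsto_pi_nhds.mpr fun i => tendsto_pi_nhds.mpr fun j => ?_
    have hd := (hf i 0 (Metric.mem_ball_self hr)).differentiableAt.hasFDerivAt
    simpa [Function.comp_def] using (hψc.tendsto _).comp (hd.lim (y j) tendsto_norm_cobounded_atTop)
  have hev := hlim.eventually (LinearIndependent.eventually hy)
  rw [← comap_norm_atTop, eventually_comap] at hev
  obtain ⟨T, hT⟩ := eventually_atTop.mp hev
  refine ⟨a, max T 1, by positivity, fun t ht => ?_⟩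
  have hmem (j : Fin n) : (t : ℚ_[p])⁻¹ • y j ∈
      (((t⁻¹ * a : ℚ_[p]ˣ) : ℚ_[p])) • Metric.ball (0 : Fin N → ℚ_[p]) r :=
    ⟨_, ha j, by simp [smul_smul]⟩
  have hli := (hT _ ((le_max_left _ _).trans ht) (t : ℚ_[p]) rfl).units_smul
    fun i => (ψ.val_isUnit ((t : ℚ_[p]) * f i 0)).unit
  rw [show (fun i => (ψ.val_isUnit ((t : ℚ_[p]) * f i 0)).unit) •
      (fun i j => ψ (t * (f i ((t : ℚ_[p])⁻¹ • y j) - f i 0))) =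
      fun i j => ψ (t * f i ((t : ℚ_[p])⁻¹ • y j)) by
    funext i j
    simp [Units.smul_def, ← AddChar.map_add_eq_mul, mul_sub]] at hli
  exact LinearIndependent.of_comp
    (LinearMap.funLeft ℂ ℂ fun j : Fin n => (⟨_, hmem j⟩ : ((((t⁻¹ * a : ℚ_[p]ˣ) : ℚ_[p])) •
      Metric.ball (0 : Fin N → ℚ_[p]) r : Set (Fin N → ℚ_[p])))) hli
end

section
/- Fix a prime p. Let N be a natural number, B an open ball centered at 0 in V = Fin N → ℚ_p of positive radius, f : V → ℚ_p analytic on B with f(0) = 0, ψ : ℚ_p → ℂ a continuous additive character, and C ⊆ V a compact set. Then there exists T > 0 such that for every t ∈ ℚ_pˣ with ‖t‖ ≥ T and every x ∈ C, one has t⁻¹·x ∈ B and ψ( t · f(t⁻¹·x) ) = ψ( (fderiv ℚ_p f 0)(x) ). -/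
/-- `ℂˣ` has no small subgroups: an element all of whose powers stay within `1 / 2` of `1`
is `1`. -/
theorem Complex.eq_one_of_forall_norm_pow_sub_one_le {z : ℂ}
    (h : ∀ n : ℕ, ‖z ^ n - 1‖ ≤ 1 / 2) : z = 1 := by
  have key : ∀ k : ℕ, (3 / 2 : ℝ) ^ k * ‖z - 1‖ ≤ ‖z ^ (2 ^ k) - 1‖ := by
    intro k
    induction k with
    | zero => simp
    | succ k ih =>
      have hfac : z ^ (2 ^ (k + 1)) - 1 = (z ^ (2 ^ k) - 1) * (z ^ (2 ^ k) + 1) := by ring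
      have hlow : (3 / 2 : ℝ) ≤ ‖z ^ (2 ^ k) + 1‖ := by
        have h2 : ‖(2 : ℂ)‖ ≤ ‖z ^ (2 ^ k) + 1‖ + ‖z ^ (2 ^ k) - 1‖ := by
          refine le_trans (le_of_eq ?_) (norm_sub_le _ _)
          congr 1
          ring
        rw [Complex.norm_ofNat] at h2
        linarith [h (2 ^ k)]
      rw [hfac, norm_mul, pow_succ]
      nlinarith [norm_nonneg (z ^ (2 ^ k) - 1), norm_nonneg (z - 1)]
  by_contra hz
  have hpos : 0 < ‖z - 1‖ := norm_pos_iff.2 (sub_ne_zero.2 hz)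
  obtain ⟨k, hk⟩ := pow_unbounded_of_one_lt (1 / ‖z - 1‖) (by norm_num : (1 : ℝ) < 3 / 2)
  rw [div_lt_iff₀ hpos] at hk
  linarith [key k, h (2 ^ k)]

/-- A continuous additive character of `ℚ_[p]` is trivial on a ball around `0`. -/
theorem AddChar.exists_pos_forall_norm_lt_eq_one {p : ℕ} [Fact p.Prime] (ψ : AddChar ℚ_[p] ℂ)
    (hψ : Continuous ψ) : ∃ δ : ℝ, 0 < δ ∧ ∀ y : ℚ_[p], ‖y‖ < δ → ψ y = 1 := by
  obtain ⟨δ, hδ, h⟩ := Metric.continuousAt_iff.1 (hψ.continuousAt (x := 0)) (1 / 2) (by norm_num)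
  refine ⟨δ, hδ, fun y hy ↦ Complex.eq_one_of_forall_norm_pow_sub_one_le fun n ↦ ?_⟩
  have hn : ‖n • y‖ < δ := by
    rw [nsmul_eq_mul, norm_mul]
    have h1 : ‖(n : ℚ_[p])‖ ≤ 1 := by exact_mod_cast Padic.norm_int_le_one (n : ℤ)
    nlinarith [norm_nonneg y]
  have := h (x := n • y) (by simpa using hn)
  rw [AddChar.map_zero_eq_one, dist_eq_norm, AddChar.map_nsmul_eq_pow] at this
  exact this.le


/-- Rescaling step: if `f` is analytic on a ball `B` around `0` in `ℚ_pᴺ` with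
`f 0 = 0`, `ψ` a continuous additive character and `C` compact, then for `‖t‖` large
enough one has `t⁻¹ • x ∈ B` and `ψ(t · f(t⁻¹ • x)) = ψ((d₀f)(x))` for all `x ∈ C`. -/
theorem character_rescaling_analytic (p : ℕ) [Fact p.Prime] (N : ℕ) (r : ℝ) (hr : 0 < r)
    (f : (Fin N → ℚ_[p]) → ℚ_[p])
    (hf : AnalyticOnNhd ℚ_[p] f (Metric.ball (0 : Fin N → ℚ_[p]) r))
    (hf0 : f 0 = 0)
    (ψ : AddChar ℚ_[p] ℂ) (hψc : Continuous ψ)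
    (C : Set (Fin N → ℚ_[p])) (hC : IsCompact C) :
    ∃ T : ℝ, 0 < T ∧ ∀ t : ℚ_[p]ˣ, T ≤ ‖(t : ℚ_[p])‖ → ∀ x ∈ C,
      ((t⁻¹ : ℚ_[p]ˣ) : ℚ_[p]) • x ∈ Metric.ball (0 : Fin N → ℚ_[p]) r ∧
      ψ ((t : ℚ_[p]) * f (((t⁻¹ : ℚ_[p]ˣ) : ℚ_[p]) • x)) = ψ (fderiv ℚ_[p] f 0 x) := by
  obtain ⟨δ, hδ, hψ⟩ := ψ.exists_pos_forall_norm_lt_eq_one hψc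
  obtain ⟨M, hM, hCM⟩ := hC.isBounded.exists_pos_norm_le
  have hd := (hf 0 (Metric.mem_ball_self hr)).differentiableAt.hasFDerivAt
  obtain ⟨η, hη, hfη⟩ := Metric.eventually_nhds_iff.1
    (hd.isLittleO.def (by positivity : 0 < δ / (2 * M)))
  have hm : 0 < min r η := lt_min hr hη
  refine ⟨2 * M / min r η, by positivity, fun t ht x hx ↦ ?_⟩
  have ht0 : 0 < ‖(t : ℚ_[p])‖ := norm_pos_iff.2 t.ne_zero
  have hv : ‖((t⁻¹ : ℚ_[p]ˣ) : ℚ_[p]) • x‖ = ‖(t : ℚ_[p])‖⁻¹ * ‖x‖ := by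
    rw [norm_smul, Units.val_inv_eq_inv_val, norm_inv]
  have hsmall : ‖((t⁻¹ : ℚ_[p]ˣ) : ℚ_[p]) • x‖ < min r η := by
    rw [hv, inv_mul_lt_iff₀ ht0]
    rw [div_le_iff₀ hm] at ht
    linarith [hCM x hx]
  refine ⟨by simpa using hsmall.trans_le (min_le_left _ _), ?_⟩
  have hbound := hfη (y := ((t⁻¹ : ℚ_[p]ˣ) : ℚ_[p]) • x)
    (by simpa using hsmall.trans_le (min_le_right _ _))
  rw [hf0, sub_zero, sub_zero, hv] at hbound
  have hdiff : ‖(t : ℚ_[p]) * f (((t⁻¹ : ℚ_[p]ˣ) : ℚ_[p]) • x) - fderiv ℚ_[p] f 0 x‖ < δ := by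
    have heq : (t : ℚ_[p]) * f (((t⁻¹ : ℚ_[p]ˣ) : ℚ_[p]) • x) - fderiv ℚ_[p] f 0 x =
        t * (f (((t⁻¹ : ℚ_[p]ˣ) : ℚ_[p]) • x) -
          fderiv ℚ_[p] f 0 (((t⁻¹ : ℚ_[p]ˣ) : ℚ_[p]) • x)) := by
      rw [map_smul, smul_eq_mul, mul_sub, Units.mul_inv_cancel_left]
    rw [heq, norm_mul]
    calc _ ≤ ‖(t : ℚ_[p])‖ * (δ / (2 * M) * (‖(t : ℚ_[p])‖⁻¹ * ‖x‖)) := by gcongr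
      _ = δ / (2 * M) * ‖x‖ := by field_simp
      _ ≤ δ / (2 * M) * M := by gcongr; exact hCM x hx
      _ = δ / 2 := by field_simp
      _ < δ := half_lt_self hδ
  rw [← sub_add_cancel ((t : ℚ_[p]) * f (((t⁻¹ : ℚ_[p]ˣ) : ℚ_[p]) • x)) (fderiv ℚ_[p] f 0 x),
    AddChar.map_add_eq_mul, hψ _ hdiff, one_mul]
end

section
/- Fix a prime p and a natural number n. Let μ be an additive Haar measure on V = Fin n → ℚ_p, let U ⊆ V be a compact open set, let O ⊇ U be open, and let f : V → ℚ_p be analytic on O with fderiv ℚ_p f x ≠ 0 for every x ∈ U (f has no critical points on U). Let ψ : ℚ_p → ℂ be a continuous nontrivial additive character. Then there exists C > 0 such that for every t ∈ ℚ_p with ‖t‖ ≥ C, ∫_{x ∈ U} ψ( t · f(x) ) dμ(x) = 0. -/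
open MeasureTheory

open Filter Topology Metric
open scoped NNReal ENNReal

section Taylor

variable {𝕜 E F : Type*} [NontriviallyNormedField 𝕜] [NormedAddCommGroup E] [NormedSpace 𝕜 E]
  [NormedAddCommGroup F] [NormedSpace 𝕜 F]

/-- The coefficients of the recentred power series satisfy Cauchy-type bounds which are uniform in
the new centre. -/
theorem FormalMultilinearSeries.exists_nnnorm_changeOrigin_mul_pow_le [CompleteSpace F]
    (q : FormalMultilinearSeries 𝕜 E F) {r r' : ℝ≥0} (hr : (r + r' : ℝ≥0∞) < q.radius) :
    ∃ K : ℝ≥0, ∀ x : E, ‖x‖₊ ≤ r → ∀ k, ‖q.changeOrigin x k‖₊ * r' ^ k ≤ K := by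
  have hs := q.changeOriginSeries_summable_aux₁ hr
  refine ⟨_, fun x hx k ↦ le_trans ?_ ((NNReal.summable_sigma.1 hs).2.le_tsum k
    fun _ _ ↦ zero_le)⟩
  have hrr : (r : ℝ≥0∞) < q.radius := lt_of_le_of_lt le_self_add hr
  have hxr : (‖x‖₊ : ℝ≥0∞) < q.radius := lt_of_le_of_lt (by exact_mod_cast hx) hrr
  change _ ≤ ∑' y : Σ l : ℕ, { s : Finset (Fin (k + l)) // s.card = l },
    ‖q (k + y.1)‖₊ * r ^ y.1 * r' ^ k
  rw [NNReal.tsum_mul_right]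
  gcongr
  refine (q.nnnorm_changeOrigin_le k hxr).trans ?_
  refine Summable.tsum_le_tsum (fun s ↦ ?_) (q.changeOriginSeries_summable_aux₂ hxr k)
    (q.changeOriginSeries_summable_aux₂ hrr k)
  gcongr

/-- First order Taylor expansion of an analytic function, with a quadratic error term that is
uniform in the base point. -/
theorem AnalyticAt.exists_norm_sub_sub_fderiv_le [CompleteSpace F] {f : E → F} {x₀ : E}
    (hf : AnalyticAt 𝕜 f x₀) :
    ∃ r > 0, ∃ M : ℝ, ∀ x ∈ ball x₀ r, ∀ h : E, ‖h‖ ≤ r →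
      ‖f (x + h) - f x - fderiv 𝕜 f x h‖ ≤ M * ‖h‖ ^ 2 := by
  obtain ⟨q, R, hq⟩ := hf
  obtain ⟨s, hs0, hsR⟩ := ENNReal.lt_iff_exists_nnreal_btwn.1 hq.r_pos
  have hs0 : 0 < s := by exact_mod_cast hs0
  have hr0 : 0 < s / 2 := by positivity
  set r := s / 2 with hr
  have hrs : r + r = s := add_halves s
  have hrR : (r + r : ℝ≥0∞) < R := by exact_mod_cast hrs ▸ hsR
  obtain ⟨K, hK⟩ := q.exists_nnnorm_changeOrigin_mul_pow_le (hrR.trans_le hq.r_le)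
  have hr0' : (0 : ℝ) < r := hr0
  refine ⟨r / 2, by positivity, 2 * (K / r ^ 2), fun x hx h hh ↦ ?_⟩
  obtain ⟨y, rfl⟩ : ∃ y, x = x₀ + y := ⟨x - x₀, by abel⟩
  have hy : ‖y‖₊ ≤ r := by
    rw [← NNReal.coe_le_coe, coe_nnnorm]
    simp only [mem_ball, dist_self_add_left] at hx
    linarith
  have hhr : ‖h‖₊ ≤ r := by
    rw [← NNReal.coe_le_coe, coe_nnnorm]
    linarith
  have hyr : (‖y‖₊ : ℝ≥0∞) ≤ r := by exact_mod_cast hy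
  have hhr' : (‖h‖₊ : ℝ≥0∞) ≤ r := by exact_mod_cast hhr
  have hyR : (‖y‖₊ : ℝ≥0∞) < R := hyr.trans_lt (lt_of_le_of_lt le_self_add hrR)
  have hqy := hq.changeOrigin hyR
  have hmem : h ∈ eball (0 : E) (R - ‖y‖₊) := by
    rw [mem_eball, edist_zero_right, enorm_eq_nnnorm]
    refine lt_tsub_iff_right.2 (lt_of_le_of_lt ?_ hrR)
    exact add_le_add hhr' hyr
  have hsum := (hasSum_nat_add_iff' 2).2 (hqy.hasSum hmem)
  have hfd := hqy.hasFPowerSeriesAt.hasFDerivAt.fderiv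
  have h0 : q.changeOrigin y 0 (fun _ ↦ h) = f (x₀ + y) := hqy.coeff_zero _
  have h1 : q.changeOrigin y 1 (fun _ ↦ h) = fderiv 𝕜 f (x₀ + y) h := by
    rw [hfd, continuousMultilinearCurryFin1_apply]
    congr 1
  rw [Finset.sum_range_succ, Finset.sum_range_one, h0, h1, ← sub_sub] at hsum
  have hgeo := (hasSum_geometric_of_lt_one (r := (1 / 2 : ℝ)) (by norm_num) (by norm_num)).mul_left
    (K * (‖h‖ / r) ^ 2)
  refine (hsum.norm_le_of_bounded hgeo fun k ↦ ?_).trans (le_of_eq ?_)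
  · have hKk : ‖q.changeOrigin y (k + 2)‖ * (r : ℝ) ^ (k + 2) ≤ K := by
      exact_mod_cast hK y hy (k + 2)
    calc ‖q.changeOrigin y (k + 2) fun _ ↦ h‖
        ≤ ‖q.changeOrigin y (k + 2)‖ * ‖h‖ ^ (k + 2) := by
          simpa using (q.changeOrigin y (k + 2)).le_opNorm fun _ ↦ h
      _ = ‖q.changeOrigin y (k + 2)‖ * (r : ℝ) ^ (k + 2) * ((‖h‖ / r) ^ 2 * (‖h‖ / r) ^ k) := by
          rw [← pow_add, div_pow, add_comm 2 k]
          field_simp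
      _ ≤ K * ((‖h‖ / r) ^ 2 * (1 / 2) ^ k) := by
          have : ‖h‖ / r ≤ 1 / 2 := by
            rw [div_le_iff₀ hr0']; linarith
          gcongr
      _ = K * (‖h‖ / r) ^ 2 * (1 / 2) ^ k := by ring
  · rw [div_pow]
    norm_num
    ring

/-- Near a non-critical point, an analytic function is uniformly approximated to second order by
its differential, and the differential is bounded below. -/
theorem AnalyticAt.exists_mem_nhds_eventually_forall_norm_sub_sub_fderiv_le [CompleteSpace F]
    {f : E → F} {x₀ : E} (hf : AnalyticAt 𝕜 f x₀) (hx₀ : fderiv 𝕜 f x₀ ≠ 0) {U : Set E}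
    (hU : U ∈ 𝓝 x₀) :
    ∃ s ∈ 𝓝 x₀, ∀ᶠ K : ℝ in atTop, ∀ x ∈ s, 1 < K * ‖fderiv 𝕜 f x‖ ∧ ∀ h : E, K * ‖h‖ ≤ 1 →
      x + h ∈ U ∧ ‖f (x + h) - f x - fderiv 𝕜 f x h‖ ≤ K * ‖h‖ ^ 2 := by
  obtain ⟨r, hr, M, hM⟩ := hf.exists_norm_sub_sub_fderiv_le
  obtain ⟨ρ, hρ, hρU⟩ := Metric.mem_nhds_iff.1 hU
  have hc : 0 < ‖fderiv 𝕜 f x₀‖ := norm_pos_iff.2 hx₀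
  have hev : ∀ᶠ x in 𝓝 x₀, ‖fderiv 𝕜 f x₀‖ / 2 < ‖fderiv 𝕜 f x‖ :=
    hf.fderiv.continuousAt.norm.eventually (lt_mem_nhds (half_lt_self hc))
  refine ⟨_, inter_mem (inter_mem (ball_mem_nhds x₀ hr) (ball_mem_nhds x₀ (half_pos hρ))) hev, ?_⟩
  filter_upwards [eventually_ge_atTop M, eventually_ge_atTop (2 / ‖fderiv 𝕜 f x₀‖),
    eventually_ge_atTop (1 / r), eventually_gt_atTop (2 / ρ)] with K hKM hKc hKr hKρ
  rintro x ⟨⟨hxr, hxρ⟩, hxc⟩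
  rw [Set.mem_ofPred_eq] at hxc
  have hK0 : 0 < K := lt_of_lt_of_le (by positivity) hKr
  refine ⟨?_, fun h hh ↦ ⟨hρU ?_, ?_⟩⟩
  · rw [div_le_iff₀ hc] at hKc
    nlinarith
  · rw [div_lt_iff₀ hρ] at hKρ
    rw [mem_ball, dist_eq_norm] at hxρ ⊢
    have hh' : ‖h‖ < ρ / 2 := by nlinarith
    calc ‖x + h - x₀‖ = ‖(x - x₀) + h‖ := by congr 1; abel
      _ ≤ ‖x - x₀‖ + ‖h‖ := norm_add_le _ _
      _ < ρ := by linarith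
  · have hh' : ‖h‖ ≤ r := by
      rw [div_le_iff₀ hr] at hKr
      nlinarith
    exact (hM x hxr h hh').trans (by gcongr)

theorem IsCompact.eventually_forall_norm_sub_sub_fderiv_le [CompleteSpace F] {f : E → F}
    {U : Set E} (hUc : IsCompact U) (hUo : IsOpen U) (hf : AnalyticOnNhd 𝕜 f U)
    (hcrit : ∀ x ∈ U, fderiv 𝕜 f x ≠ 0) :
    ∀ᶠ K : ℝ in atTop, ∀ x ∈ U, 1 < K * ‖fderiv 𝕜 f x‖ ∧ ∀ h : E, K * ‖h‖ ≤ 1 →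
      x + h ∈ U ∧ ‖f (x + h) - f x - fderiv 𝕜 f x h‖ ≤ K * ‖h‖ ^ 2 := by
  refine hUc.induction_on (p := fun s ↦ ∀ᶠ K : ℝ in atTop, ∀ x ∈ s, 1 < K * ‖fderiv 𝕜 f x‖ ∧
    ∀ h : E, K * ‖h‖ ≤ 1 → x + h ∈ U ∧ ‖f (x + h) - f x - fderiv 𝕜 f x h‖ ≤ K * ‖h‖ ^ 2)
    (by simp) (fun s t hst ht ↦ ht.mono fun K hK x hx ↦ hK x (hst hx)) (fun s t hs ht ↦ ?_)
    fun x hx ↦ ?_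
  · filter_upwards [hs, ht] with K hKs hKt x hx
    exact hx.elim (hKs x) (hKt x)
  · obtain ⟨s, hs, h⟩ := (hf x hx).exists_mem_nhds_eventually_forall_norm_sub_sub_fderiv_le
      (hcrit x hx) (hUo.mem_nhds hx)
    exact ⟨s, mem_nhdsWithin_of_mem_nhds hs, h⟩

end Taylor

/-- A clopen set glues a function continuous on it with zero. -/
theorem IsClopen.continuous_indicator_of_continuousOn {X Y : Type*} [TopologicalSpace X]
    [TopologicalSpace Y] [Zero Y] {s : Set X} (hs : IsClopen s) {g : X → Y}
    (hg : ContinuousOn g s) : Continuous (s.indicator g) := by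
  refine continuous_iff_continuousAt.2 fun x ↦ ?_
  by_cases hx : x ∈ s
  · refine (hg.continuousAt (hs.isOpen.mem_nhds hx)).congr ?_
    filter_upwards [hs.isOpen.mem_nhds hx] with y hy
    simp [hy]
  · refine (continuousAt_const (y := (0 : Y))).congr ?_
    filter_upwards [hs.isClosed.isOpen_compl.mem_nhds hx] with y hy
    exact (Set.indicator_of_notMem hy g).symm

theorem Complex.eq_one_of_forall_norm_pow_two_pow_sub_one_lt {z : ℂ}
    (hz : ∀ k : ℕ, ‖z ^ 2 ^ k - 1‖ < 1 / 2) : z = 1 := by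
  have hgrow : ∀ k : ℕ, (3 / 2 : ℝ) ^ k * ‖z - 1‖ ≤ ‖z ^ 2 ^ k - 1‖ := by
    intro k
    induction k with
    | zero => simp
    | succ k ih =>
      have hw := hz k
      have hstep : z ^ 2 ^ (k + 1) - 1 = (z ^ 2 ^ k + 1) * (z ^ 2 ^ k - 1) := by
        rw [pow_succ, pow_mul]; ring
      have hfac : (3 / 2 : ℝ) ≤ ‖z ^ 2 ^ k + 1‖ := by
        have h2 : ‖(2 : ℂ)‖ ≤ ‖z ^ 2 ^ k + 1‖ + ‖z ^ 2 ^ k - 1‖ := by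
          refine le_trans (le_of_eq ?_) (norm_sub_le _ _)
          congr 1; ring
        rw [Complex.norm_ofNat] at h2
        linarith
      rw [hstep, norm_mul, pow_succ]
      calc (3 / 2 : ℝ) ^ k * (3 / 2) * ‖z - 1‖ = 3 / 2 * ((3 / 2) ^ k * ‖z - 1‖) := by ring
        _ ≤ _ := by gcongr
  by_contra hne
  have hpos : 0 < ‖z - 1‖ := norm_pos_iff.2 (sub_ne_zero.2 hne)
  obtain ⟨k, hk⟩ := pow_unbounded_of_one_lt (1 / ‖z - 1‖) (by norm_num : (1 : ℝ) < 3 / 2)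
  rw [div_lt_iff₀ hpos] at hk
  linarith [hgrow k, hz k]

/-- A continuous character of an ultrametric group is trivial near the origin, as `ℂˣ` has no small
subgroups. -/
theorem AddChar.exists_forall_norm_lt_eq_one {G : Type*} [SeminormedAddCommGroup G]
    [IsUltrametricDist G] (ψ : AddChar G ℂ) (hψ : Continuous ψ) :
    ∃ δ > 0, ∀ x : G, ‖x‖ < δ → ψ x = 1 := by
  obtain ⟨δ, hδ, h⟩ := Metric.continuousAt_iff.1 (hψ.continuousAt (x := 0)) (1 / 2) (by norm_num)
  refine ⟨δ, hδ, fun x hx ↦ Complex.eq_one_of_forall_norm_pow_two_pow_sub_one_lt fun k ↦ ?_⟩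
  have hk : ‖2 ^ k • x‖ < δ := (IsUltrametricDist.norm_nsmul_le _ _).trans_lt hx
  have hψk := h (x := 2 ^ k • x) (by simpa only [dist_zero_right] using hk)
  rwa [AddChar.map_zero_eq_one, AddChar.map_nsmul_eq_pow, dist_eq_norm] at hψk

/-- Orthogonality: a character integrates to zero over a subgroup on which it is nontrivial. -/
theorem AddChar.setIntegral_eq_zero {G : Type*} [AddCommGroup G] [MeasurableSpace G]
    [MeasurableAdd G] (μ : Measure G) [μ.IsAddRightInvariant] {H : AddSubgroup G}
    (hH : MeasurableSet (H : Set G)) (χ : AddChar G ℂ) {a : G} (ha : a ∈ H) (hχ : χ a ≠ 1) :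
    ∫ x in H, χ x ∂μ = 0 := by
  have h := integral_add_right_eq_self (μ := μ) ((H : Set G).indicator χ) a
  have h' : ∀ x, (H : Set G).indicator χ (x + a) = χ a * (H : Set G).indicator χ x := by
    intro x
    by_cases hx : x ∈ H
    · rw [Set.indicator_of_mem (H.add_mem hx ha), Set.indicator_of_mem (show x ∈ (H : Set G) from hx),
        AddChar.map_add_eq_mul, mul_comm]
    · rw [Set.indicator_of_notMem (show x ∉ (H : Set G) from hx), mul_zero,
        Set.indicator_of_notMem]
      exact fun h ↦ hx ((H.add_mem_cancel_right ha).1 h)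
  simp_rw [h', integral_const_mul, integral_indicator hH] at h
  exact (mul_left_eq_self₀.1 h).resolve_left hχ

/-- If all averages of `g` over translates of a compact open set `H` vanish, then so does the
integral of `g`. -/
theorem integral_eq_zero_of_forall_setIntegral_add_eq_zero {G : Type*} [AddCommGroup G]
    [TopologicalSpace G] [IsTopologicalAddGroup G] [T2Space G] [MeasurableSpace G] [BorelSpace G]
    (μ : Measure G) [μ.IsAddHaarMeasure] {g : G → ℂ} (hg : Continuous g)
    (hgc : HasCompactSupport g) {H : Set G} (hHc : IsCompact H) (hHo : IsOpen H)
    (hHne : H.Nonempty) (h : ∀ x, ∫ y in H, g (x + y) ∂μ = 0) : ∫ x, g x ∂μ = 0 := by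
  have hHm : MeasurableSet H := hHo.measurableSet
  set Φ : G → G → ℂ := fun x y ↦ H.indicator (fun y ↦ g (x + y)) y with hΦ
  have hΦu : Φ.uncurry = (Prod.snd ⁻¹' H).indicator fun z : G × G ↦ g (z.1 + z.2) := by
    ext ⟨x, y⟩
    rfl
  have hcont : Continuous Φ.uncurry := by
    rw [hΦu]
    have hH : IsClopen H := ⟨hHc.isClosed, hHo⟩
    exact (hH.preimage continuous_snd).continuous_indicator_of_continuousOn
      (hg.comp (continuous_fst.add continuous_snd)).continuousOn
  have hcomp : HasCompactSupport Φ.uncurry := by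
    refine HasCompactSupport.intro ((hgc.isCompact.prod hHc).image
      (f := fun z : G × G ↦ (z.1 - z.2, z.2)) (by fun_prop)) ?_
    rintro ⟨x, y⟩ hxy
    by_contra hne
    have hy : y ∈ H := by
      by_contra hy
      exact hne (by simp [hΦ, hy])
    refine hxy ⟨(x + y, y), ⟨subset_tsupport g fun h0 ↦ hne ?_, hy⟩, by simp⟩
    simpa [hΦ, hy] using h0
  have hswap := integral_integral_swap_of_hasCompactSupport hcont hcomp (μ := μ) (ν := μ)
  have hleft : ∀ x, ∫ y, Φ x y ∂μ = 0 := fun x ↦ by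
    rw [← h x, ← integral_indicator hHm]
  have hright : ∀ y, ∫ x, Φ x y ∂μ = H.indicator (fun _ ↦ ∫ x, g x ∂μ) y := fun y ↦ by
    by_cases hy : y ∈ H
    · simpa [hΦ, hy] using integral_add_right_eq_self (μ := μ) g y
    · simp [hΦ, hy]
  simp_rw [hleft, hright, integral_zero, integral_indicator hHm, setIntegral_const] at hswap
  refine (smul_eq_zero.1 hswap.symm).resolve_left ?_
  exact (ENNReal.toReal_pos (hHo.measure_pos μ hHne).ne' hHc.measure_lt_top.ne).ne'

theorem ContinuousLinearMap.exists_apply_eq_of_lt {𝕜 E : Type*} [NontriviallyNormedField 𝕜]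
    [NormedAddCommGroup E] [NormedSpace 𝕜 E] (L : E →L[𝕜] 𝕜) {a : 𝕜} {s : ℝ} (hs : 0 < s)
    (ha : ‖a‖ < s * ‖L‖) : ∃ h : E, ‖h‖ ≤ s ∧ L h = a := by
  by_contra! hne
  refine ha.not_ge ?_
  rw [← le_div_iff₀' hs]
  refine L.opNorm_le_bound (by positivity) fun v ↦ ?_
  by_cases hv : L v = 0
  · rw [hv, norm_zero]; positivity
  have hLv : 0 < ‖L v‖ := norm_pos_iff.2 hv
  have hsv : s < ‖(a / L v) • v‖ := by
    by_contra! hle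
    exact hne _ hle (by simp [hv])
  rw [norm_smul, norm_div, div_mul_eq_mul_div, lt_div_iff₀ hLv] at hsv
  rw [div_mul_eq_mul_div, le_div_iff₀' hs]
  exact hsv.le

/-- Stationary phase over `ℚ_p`, no-critical-points case: if `f` is analytic on an
open set containing the compact open set `U` and has no critical points on `U`, then
the oscillatory integral `∫_U ψ(t f(x)) dμ(x)` vanishes for `‖t‖` large enough. -/
theorem stationary_phase_no_critical_points (p : ℕ) [Fact p.Prime] (n : ℕ)
    [MeasurableSpace (Fin n → ℚ_[p])] [BorelSpace (Fin n → ℚ_[p])]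
    (μ : Measure (Fin n → ℚ_[p])) [μ.IsAddHaarMeasure]
    (U O : Set (Fin n → ℚ_[p])) (hUc : IsCompact U) (hUo : IsOpen U)
    (hO : IsOpen O) (hUO : U ⊆ O)
    (f : (Fin n → ℚ_[p]) → ℚ_[p]) (hf : AnalyticOnNhd ℚ_[p] f O)
    (hcrit : ∀ x ∈ U, fderiv ℚ_[p] f x ≠ 0)
    (ψ : AddChar ℚ_[p] ℂ) (hψc : Continuous ψ) (hψ : ∃ x, ψ x ≠ 1) :
    ∃ C : ℝ, 0 < C ∧ ∀ t : ℚ_[p], C ≤ ‖t‖ →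
      ∫ x in U, ψ (t * f x) ∂μ = 0 := by
  have hfU : AnalyticOnNhd ℚ_[p] f U := hf.mono hUO
  obtain ⟨δ, hδ, hψδ⟩ := ψ.exists_forall_norm_lt_eq_one hψc
  obtain ⟨a, ha⟩ := hψ
  have ha0 : 0 < ‖a‖ := norm_pos_iff.2 fun h ↦ ha (by rw [h, AddChar.map_zero_eq_one])
  obtain ⟨K, hK, hK0⟩ := ((hUc.eventually_forall_norm_sub_sub_fderiv_le hUo hfU hcrit).and
    (eventually_gt_atTop 0)).exists
  set A := K * ‖a‖ with hA
  have hA0 : 0 < A := by positivity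
  refine ⟨K * A + K * A ^ 2 / δ + 1, by positivity, fun t ht ↦ ?_⟩
  have hAδ : 0 < K * A ^ 2 / δ := by positivity
  have ht0 : 0 < ‖t‖ := lt_of_lt_of_le (by positivity) ht
  have ht_ne : t ≠ 0 := norm_pos_iff.1 ht0
  set s := A / ‖t‖ with hs
  have hs0 : 0 < s := by positivity
  have hKs : K * s ≤ 1 := by
    rw [hs, ← mul_div_assoc, div_le_one ht0]
    linarith
  have hts : ‖t‖ * (K * s ^ 2) < δ := by
    have h1 : K * A ^ 2 < ‖t‖ * δ := by
      rw [← div_lt_iff₀ hδ]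
      have : 0 < K * A := by positivity
      linarith
    calc ‖t‖ * (K * s ^ 2) = K * A ^ 2 / ‖t‖ := by rw [hs]; field_simp
      _ < δ := by rwa [div_lt_iff₀ ht0, mul_comm δ]
  have hcl : IsClopen U := ⟨hUc.isClosed, hUo⟩
  have hgc : ContinuousOn (fun x ↦ ψ (t * f x)) U :=
    hψc.comp_continuousOn (continuousOn_const.mul hfU.continuousOn)
  rw [← integral_indicator hUo.measurableSet]
  let H : OpenAddSubgroup (Fin n → ℚ_[p]) :=
    IsUltrametricDist.closedBall_openAddSubgroup (Fin n → ℚ_[p]) hs0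
  have hHs : (H : Set (Fin n → ℚ_[p])) = closedBall 0 s := rfl
  have hHc : IsCompact (H : Set (Fin n → ℚ_[p])) := hHs ▸ isCompact_closedBall 0 s
  refine integral_eq_zero_of_forall_setIntegral_add_eq_zero μ
    (hcl.continuous_indicator_of_continuousOn hgc)
    (HasCompactSupport.intro hUc fun x hx ↦ Set.indicator_of_notMem hx _) hHc H.isOpen
    ⟨0, H.zero_mem⟩ fun x ↦ ?_
  have hHm : MeasurableSet (H : Set (Fin n → ℚ_[p])) := H.isOpen.measurableSet
  have hH : ∀ h ∈ (H : Set (Fin n → ℚ_[p])), K * ‖h‖ ≤ 1 ∧ ‖h‖ ≤ s := fun h hh ↦ by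
    rw [hHs, mem_closedBall_zero_iff] at hh
    exact ⟨le_trans (by gcongr) hKs, hh⟩
  by_cases hx : x ∈ U
  · obtain ⟨hfd, hexp⟩ := hK x hx
    set L := fderiv ℚ_[p] f x
    let χ : AddChar (Fin n → ℚ_[p]) ℂ :=
      ψ.compAddMonoidHom ((AddMonoidHom.mulLeft t).comp (L : (Fin n → ℚ_[p]) →+ ℚ_[p]))
    have hχ : ∀ h, χ h = ψ (t * L h) := fun h ↦ rfl
    obtain ⟨h₀, hh₀, hLh₀⟩ := L.exists_apply_eq_of_lt (a := a / t) hs0 (by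
      rw [norm_div, hs, hA, div_mul_eq_mul_div]
      gcongr
      nlinarith)
    have hχ0 : ∫ h in H, χ h ∂μ = 0 := by
      refine χ.setIntegral_eq_zero μ (H := H.toAddSubgroup) hHm (a := h₀) ?_ ?_
      · exact mem_closedBall_zero_iff.2 hh₀
      · rwa [hχ, hLh₀, mul_div_cancel₀ _ ht_ne]
    rw [setIntegral_congr_fun (g := fun h ↦ ψ (t * f x) * χ h) hHm, integral_const_mul, hχ0,
      mul_zero]
    intro h hh
    obtain ⟨hhK, hhs⟩ := hH h hh
    obtain ⟨hmem, herr⟩ := hexp h hhK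
    have hsplit : t * f (x + h) = t * f x + t * L h + t * (f (x + h) - f x - L h) := by ring
    have htriv : ψ (t * (f (x + h) - f x - L h)) = 1 := by
      refine hψδ _ (lt_of_le_of_lt ?_ hts)
      rw [norm_mul]
      gcongr
      exact herr.trans (by gcongr)
    simp only [Set.indicator_of_mem hmem, hχ]
    rw [hsplit, AddChar.map_add_eq_mul, AddChar.map_add_eq_mul, htriv, mul_one]
  · refine (setIntegral_congr_fun hHm (g := fun _ ↦ (0 : ℂ)) fun h hh ↦ ?_).trans (by simp)
    refine Set.indicator_of_notMem (fun hmem ↦ hx ?_) _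
    have := ((hK _ hmem).2 (-h) (by rw [norm_neg]; exact (hH h hh).1)).1
    rwa [add_neg_cancel_right] at this
end

section
/- Fix a prime p. Let N and n be natural numbers, V = Fin N → ℚ_p, ψ : ℚ_p → ℂ a continuous nontrivial additive character, and λ : Fin n → (V →ₗ[ℚ_p] ℚ_p) a family of linear functionals that is linearly independent over ℚ_p. Then there exists a compact open set C ⊆ V containing 0 such that the n functions v ↦ ψ(λ i (v)), restricted to C, are linearly independent over ℂ. -/
/-- A family of pairwise distinct additive characters with values in a domain is linearly
independent. -/
theorem AddChar.linearIndependent_of_injective {ι G R : Type*} [AddMonoid G] [CommRing R]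
    [IsDomain R] {χ : ι → AddChar G R} (hχ : Function.Injective χ) :
    LinearIndependent R (fun i => (χ i : G → R)) :=
  (linearIndependent_monoidHom (Multiplicative G) R).comp (fun i => (χ i).toMonoidHom)
    fun _ _ h => hχ (AddChar.toMonoidHomEquiv.injective h)

/-- A nontrivial additive character of a field, composed with distinct linear functionals, gives
functions that differ at some point. -/
theorem AddChar.exists_apply_ne_of_ne {K V R : Type*} [Field K] [AddCommGroup V] [Module K V]
    [CommRing R] {ψ : AddChar K R} (hψ : ∃ x, ψ x ≠ 1) {f g : V →ₗ[K] K} (hfg : f ≠ g) :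
    ∃ v, ψ (f v) ≠ ψ (g v) := by
  obtain ⟨x, hx⟩ := hψ
  obtain ⟨w, hw⟩ := LinearMap.surjective (sub_ne_zero.2 hfg) x
  refine ⟨w, fun h => hx ?_⟩
  rw [← hw, LinearMap.sub_apply, sub_eq_add_neg, AddChar.map_add_eq_mul, h,
    ← AddChar.map_add_eq_mul, add_neg_cancel, AddChar.map_zero_eq_one]

/-- If `λ₁, …, λₙ` are linearly independent linear functionals on `ℚ_pᴺ` and `ψ` is a
nontrivial continuous additive character of `ℚ_p`, then there is a compact open set
`C` containing `0` such that the functions `v ↦ ψ(λᵢ(v))` restricted to `C` are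
linearly independent over ℂ. -/
theorem characters_of_independent_functionals_linearIndependent (p : ℕ) [Fact p.Prime]
    (N n : ℕ) (ψ : AddChar ℚ_[p] ℂ) (hψc : Continuous ψ) (hψ : ∃ x, ψ x ≠ 1)
    (lam : Fin n → ((Fin N → ℚ_[p]) →ₗ[ℚ_[p]] ℚ_[p]))
    (hind : LinearIndependent ℚ_[p] lam) :
    ∃ C : Set (Fin N → ℚ_[p]), IsCompact C ∧ IsOpen C ∧ (0 : Fin N → ℚ_[p]) ∈ C ∧
      LinearIndependent ℂ (fun i : Fin n => (fun x : C => ψ (lam i (x : Fin N → ℚ_[p])))) := by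
  choose! v hv using fun i j (h : i ≠ j) =>
    AddChar.exists_apply_ne_of_ne hψ (hind.injective.ne h)
  obtain ⟨r, hr, hvr⟩ : ∃ r > 0, ∀ i j, ‖v i j‖ ≤ r := by
    obtain ⟨r, hr, h⟩ :=
      (Set.finite_range fun q : Fin n × Fin n => v q.1 q.2).isBounded.exists_pos_norm_le
    exact ⟨r, hr, fun i j => h _ ⟨(i, j), rfl⟩⟩
  let H := IsUltrametricDist.closedBall_openAddSubgroup (Fin N → ℚ_[p]) hr
  refine ⟨H, isCompact_closedBall 0 r, H.isOpen, H.zero_mem, ?_⟩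
  refine AddChar.linearIndependent_of_injective (G := H)
    (χ := fun i => ψ.compAddMonoidHom ((lam i).toAddMonoidHom.comp H.toAddSubgroup.subtype))
    fun i j hij => ?_
  by_contra hne
  exact hv i j hne (DFunLike.congr_fun hij ⟨v i j, mem_closedBall_zero_iff.2 (hvr i j)⟩)
end
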